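/- arXiv:1506.03397 — 2 statements merged into one kernel-verified Lean document; each statement's English description precedes it below -/
import Mathlib

section
/- Let (e_n, e_n*) be a semi-normalized bounded biorthogonal system in an infinite-dimensional Banach space X. Then the system is 1-greedy if and only if it is 1-suppression unconditional and has Property (A). -/
open Finset

variable {𝕜 X : Type*}

section Defs

variable (𝕜) [RCLike 𝕜] [NormedAddCommGroup X] [NormedSpace 𝕜 X]

/-- A semi-normalized bounded biorthogonal system: biorthogonality, totality of the span,
and a uniform bound on the norms of the vectors and the functionals. -/
def BiorthSystem (e : ℕ → X) (f : ℕ → X →L[𝕜] 𝕜) : Prop :=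
  (∀ n k, f n (e k) = if n = k then (1 : 𝕜) else 0) ∧
  (Submodule.span 𝕜 (Set.range e)).topologicalClosure = ⊤ ∧
  ∃ M : ℝ, ∀ n, ‖e n‖ ≤ M ∧ ‖f n‖ ≤ M

variable {𝕜}

/-- The projection `P_A x = ∑_{n ∈ A} e_n*(x) e_n`. -/
noncomputable def greedyProj (e : ℕ → X) (f : ℕ → X →L[𝕜] 𝕜) (A : Finset ℕ) (x : X) : X :=
  ∑ n ∈ A, f n x • e n

/-- `A` is a greedy set for `x`: the coefficients on `A` dominate those outside `A`. -/
def IsGreedySet (f : ℕ → X →L[𝕜] 𝕜) (x : X) (A : Finset ℕ) : Prop :=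
  ∀ n ∈ A, ∀ k ∉ A, ‖f k x‖ ≤ ‖f n x‖

/-- The system is `C`-almost greedy. -/
def AlmostGreedyWith (e : ℕ → X) (f : ℕ → X →L[𝕜] 𝕜) (C : ℝ) : Prop :=
  ∀ (x : X) (A : Finset ℕ), IsGreedySet f x A →
    ∀ B : Finset ℕ, B.card ≤ A.card →
      ‖x - greedyProj e f A x‖ ≤ C * ‖x - greedyProj e f B x‖

/-- The system is `C`-suppression quasi-greedy. -/
def SuppressionQuasiGreedyWith (e : ℕ → X) (f : ℕ → X →L[𝕜] 𝕜) (C : ℝ) : Prop :=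
  ∀ (x : X) (A : Finset ℕ), IsGreedySet f x A →
    ‖x - greedyProj e f A x‖ ≤ C * ‖x‖

/-- The system is `K`-suppression unconditional. -/
def SuppressionUnconditionalWith (e : ℕ → X) (f : ℕ → X →L[𝕜] 𝕜) (K : ℝ) : Prop :=
  ∀ (x : X) (A : Finset ℕ), ‖x - greedyProj e f A x‖ ≤ K * ‖x‖

/-- The system is `C`-greedy. -/
def GreedyWith (e : ℕ → X) (f : ℕ → X →L[𝕜] 𝕜) (C : ℝ) : Prop :=
  ∀ (x : X) (A : Finset ℕ), IsGreedySet f x A →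
    ∀ (B : Finset ℕ), B.card = A.card → ∀ α : ℕ → 𝕜,
      ‖x - greedyProj e f A x‖ ≤ C * ‖x - ∑ n ∈ B, α n • e n‖

/-- The system is `C`-symmetric for largest coefficients; for `C = 1` this is Property (A). -/
def SymmetricLargestCoeffsWith (e : ℕ → X) (f : ℕ → X →L[𝕜] 𝕜) (C : ℝ) : Prop :=
  ∀ (z : X) (A B : Finset ℕ), Disjoint A B → A.card = B.card →
    (∀ n ∈ A ∪ B, f n z = 0) →
    ∀ (ε θ : ℕ → 𝕜), (∀ n ∈ A, ‖ε n‖ = 1) → (∀ n ∈ B, ‖θ n‖ = 1) →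
    ∀ t : 𝕜, (∀ n, ‖f n z‖ ≤ ‖t‖) →
      ‖z + t • ∑ n ∈ B, θ n • e n‖ ≤ C * ‖z + t • ∑ n ∈ A, ε n • e n‖

end Defs

theorem aux_coef {𝕜 X : Type*} [RCLike 𝕜] [NormedAddCommGroup X] [NormedSpace 𝕜 X] 
    (e : ℕ → X) (f : ℕ → X →L[𝕜] 𝕜)
    (h : ∀ n k, f n (e k) = if n = k then (1 : 𝕜) else 0) (S : Finset ℕ) (a : ℕ → 𝕜) (m : ℕ) :
    f m (∑ n ∈ S, a n • e n) = if m ∈ S then a m else 0 := by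
  simp [map_sum, h]

theorem aux_mult {𝕜 X : Type*} [RCLike 𝕜] [NormedAddCommGroup X] [NormedSpace 𝕜 X] 
    (e : ℕ → X) (f : ℕ → X →L[𝕜] 𝕜)
    (h : ∀ n k, f n (e k) = if n = k then (1 : 𝕜) else 0)
    (hS : SuppressionUnconditionalWith e f 1) (a b : ℕ → 𝕜) (l : ℕ → ℝ) (S : Finset ℕ) :
    ∀ z : X, (∀ n ∈ S, f n z = 0) →
    (∀ n ∈ S, 0 ≤ l n ∧ l n ≤ 1 ∧ a n = (l n : 𝕜) * b n) →
    ‖z + ∑ n ∈ S, a n • e n‖ ≤ ‖z + ∑ n ∈ S, b n • e n‖ := by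
  induction S using Finset.induction_on with
  | empty => intro z _ _; simp
  | insert m S hm ih =>
    intro z hz hl
    obtain ⟨h0, h1, ha⟩ := hl m (Finset.mem_insert_self _ _)
    have hne : ∀ n ∈ S, n ≠ m := fun n hn hnm => hm (hnm ▸ hn)
    have h2 := ih (z + a m • e m)
      (fun n hn => by
        simp [hz n (Finset.mem_insert_of_mem hn), h, hne n hn])
      (fun n hn => hl n (Finset.mem_insert_of_mem hn))
    rw [Finset.sum_insert hm, Finset.sum_insert hm, ← add_assoc, ← add_assoc]
    refine h2.trans ?_
    set w := z + b m • e m + ∑ n ∈ S, b n • e n with hw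
    have hfw : f m w = b m := by
      rw [hw, map_add, map_add, aux_coef e f h, hz m (Finset.mem_insert_self _ _)]
      simp [hm, h]
    have h3 := hS w {m}
    have e1 : z + a m • e m + ∑ n ∈ S, b n • e n
        = (l m : 𝕜) • w + ((1 - l m : ℝ) : 𝕜) • (w - greedyProj e f {m} w) := by
      simp only [greedyProj, Finset.sum_singleton, hfw]
      rw [ha, hw]
      push_cast
      module
    rw [e1]
    refine (norm_add_le _ _).trans ?_
    rw [norm_smul, norm_smul, RCLike.norm_ofReal, RCLike.norm_ofReal, abs_of_nonneg h0,
      abs_of_nonneg (by linarith)]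
    nlinarith

theorem aux_sgn {𝕜 : Type*} [RCLike 𝕜] (c : 𝕜) : ∃ u : 𝕜, ‖u‖ = 1 ∧ c = (‖c‖ : 𝕜) * u := by
  by_cases hc : c = 0
  · exact ⟨1, by simp, by simp [hc]⟩
  · have : (‖c‖ : 𝕜) ≠ 0 := by simpa using hc
    refine ⟨c / (‖c‖ : 𝕜), ?_, ?_⟩
    · rw [norm_div, RCLike.norm_ofReal, abs_norm, div_self (by simpa using hc)]
    · field_simp

theorem aux_fwd1 {𝕜 X : Type*} [RCLike 𝕜] [NormedAddCommGroup X] [NormedSpace 𝕜 X] 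
    (e : ℕ → X) (f : ℕ → X →L[𝕜] 𝕜) (hsys : BiorthSystem 𝕜 e f)
    (hG : GreedyWith e f 1) : SuppressionUnconditionalWith e f 1 := by
  obtain ⟨h, -, M, hM⟩ := hsys
  intro x A
  have hM0 : 0 ≤ M := (norm_nonneg _).trans (hM 0).1
  have hb : ∀ n, ‖f n x‖ ≤ M * ‖x‖ := fun n =>
    ((f n).le_opNorm x).trans (mul_le_mul_of_nonneg_right (hM n).2 (norm_nonneg _))
  set s : 𝕜 := ((M * ‖x‖ : ℝ) : 𝕜) with hs
  have hsn : ‖s‖ = M * ‖x‖ := by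
    rw [hs, RCLike.norm_ofReal, abs_of_nonneg (by positivity)]
  set y := x + ∑ n ∈ A, (s - f n x) • e n with hy
  have hfy : ∀ n, f n y = if n ∈ A then s else f n x := by
    intro n
    rw [hy, map_add, aux_coef e f h]
    split_ifs <;> simp
  have hg : IsGreedySet f y A := by
    intro n hn k hk
    rw [hfy, hfy, if_pos hn, if_neg hk, hsn]
    exact hb k
  have := hG y A hg A rfl (fun n => s - f n x)
  have e1 : y - greedyProj e f A y = x - greedyProj e f A x := by
    have : greedyProj e f A y = ∑ n ∈ A, s • e n :=
      Finset.sum_congr rfl (fun n hn => by rw [hfy, if_pos hn])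
    rw [this, hy]
    simp only [greedyProj, sub_smul, Finset.sum_sub_distrib]
    abel
  have e2 : y - ∑ n ∈ A, (s - f n x) • e n = x := by rw [hy]; abel
  rwa [e1, e2] at this

theorem aux_fwd2 {𝕜 X : Type*} [RCLike 𝕜] [NormedAddCommGroup X] [NormedSpace 𝕜 X] 
    (e : ℕ → X) (f : ℕ → X →L[𝕜] 𝕜) (hsys : BiorthSystem 𝕜 e f)
    (hG : GreedyWith e f 1) : SymmetricLargestCoeffsWith e f 1 := by
  obtain ⟨h, -, -⟩ := hsys
  intro z A B hd hc hz ε θ hε hθ t ht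
  set x := z + ∑ n ∈ B, (t * θ n) • e n + ∑ n ∈ A, (t * ε n) • e n with hx
  have hfx : ∀ n, f n x = f n z + (if n ∈ B then t * θ n else 0)
      + (if n ∈ A then t * ε n else 0) := by
    intro n
    rw [hx, map_add, map_add, aux_coef e f h, aux_coef e f h]
  have hA : ∀ n ∈ A, f n x = t * ε n := by
    intro n hn
    rw [hfx, hz n (Finset.mem_union_left _ hn), if_pos hn,
      if_neg (Finset.disjoint_left.1 hd hn)]
    simp
  have hg : IsGreedySet f x A := by
    intro n hn k hk
    rw [hA n hn, norm_mul, hε n hn, mul_one, hfx, if_neg hk]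
    by_cases hkB : k ∈ B
    · rw [if_pos hkB, hz k (Finset.mem_union_right _ hkB)]
      simp [hθ k hkB]
    · simpa [hkB] using ht k
  have := hG x A hg B hc.symm (fun n => t * θ n)
  have e1 : greedyProj e f A x = ∑ n ∈ A, (t * ε n) • e n :=
    Finset.sum_congr rfl (fun n hn => by rw [hA n hn])
  have e2 : x - ∑ n ∈ B, (t * θ n) • e n = z + ∑ n ∈ A, (t * ε n) • e n := by
    rw [hx]; abel
  have e3 : x - ∑ n ∈ A, (t * ε n) • e n = z + ∑ n ∈ B, (t * θ n) • e n := by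
    rw [hx]; abel
  rw [e1, e2, e3] at this
  simpa only [Finset.smul_sum, smul_smul] using this

theorem aux_bwd {𝕜 X : Type*} [RCLike 𝕜] [NormedAddCommGroup X] [NormedSpace 𝕜 X] 
    (e : ℕ → X) (f : ℕ → X →L[𝕜] 𝕜) (hsys : BiorthSystem 𝕜 e f)
    (hS : SuppressionUnconditionalWith e f 1) (hA : SymmetricLargestCoeffsWith e f 1) :
    GreedyWith e f 1 := by
  obtain ⟨h, -, -⟩ := hsys
  intro x A hg B hc α
  rcases A.eq_empty_or_nonempty with rfl | hne
  · have : B = ∅ := by simpa using hc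
    subst this
    simp [greedyProj]
  obtain ⟨m, hm, hmin⟩ := A.exists_min_image (fun n => ‖f n x‖) hne
  set t : ℝ := ‖f m x‖ with ht
  have ht0 : 0 ≤ t := norm_nonneg _
  have hout : ∀ k ∉ A, ‖f k x‖ ≤ t := fun k hk => hg m hm k hk
  choose u hu hxu using fun n => aux_sgn (f n x)
  set z := x - ∑ n ∈ A ∪ B, f n x • e n with hz
  have hfz : ∀ n, f n z = if n ∈ A ∪ B then 0 else f n x := by
    intro n
    rw [hz, map_sub, aux_coef e f h (A ∪ B) (fun n => f n x)]
    split_ifs <;> simp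
  have hfz0 : ∀ n ∈ A ∪ B, f n z = 0 := fun n hn => by rw [hfz, if_pos hn]
  have hcard : (A \ B).card = (B \ A).card := (Finset.card_sdiff_comm hc).symm
  have e1 : x - greedyProj e f A x = z + ∑ n ∈ B \ A, f n x • e n := by
    have : A ∪ B = A ∪ (B \ A) := by simp
    rw [hz, this, Finset.sum_union Finset.disjoint_sdiff, greedyProj]
    abel
  set y := x - ∑ n ∈ B, α n • e n with hy
  have e2 : y - greedyProj e f B y = z + ∑ n ∈ A \ B, f n x • e n := by
    have hfy : ∀ n ∈ B, f n y = f n x - α n := by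
      intro n hn
      rw [hy, map_sub, aux_coef e f h, if_pos hn]
    have e3 : greedyProj e f B y = ∑ n ∈ B, f n x • e n - ∑ n ∈ B, α n • e n := by
      rw [← Finset.sum_sub_distrib]
      exact Finset.sum_congr rfl (fun n hn => by rw [hfy n hn, sub_smul])
    have : A ∪ B = (A \ B) ∪ B := by simp
    rw [hz, e3, hy, this, Finset.sum_union Finset.sdiff_disjoint]
    abel
  have s1 := aux_mult e f h hS (fun n => f n x) (fun n => (t : 𝕜) * u n)
    (fun n => ‖f n x‖ / t) (B \ A) z
    (fun n hn => hfz0 n (Finset.mem_union_right _ (Finset.mem_sdiff.1 hn).1))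
    (fun n hn => by
      have hle := hout n (Finset.mem_sdiff.1 hn).2
      refine ⟨by positivity, div_le_one_of_le₀ hle ht0, ?_⟩
      rcases ht0.eq_or_lt with h0 | h0
      · have : f n x = 0 := by
          rw [← norm_le_zero_iff]; linarith
        simp [this]
      · have h0' : (t : 𝕜) ≠ 0 := by exact_mod_cast h0.ne'
        push_cast
        rw [← mul_assoc, div_mul_cancel₀ _ h0']
        exact hxu n)
  have s3 := aux_mult e f h hS (fun n => (t : 𝕜) * u n) (fun n => f n x)
    (fun n => t / ‖f n x‖) (A \ B) z
    (fun n hn => hfz0 n (Finset.mem_union_left _ (Finset.mem_sdiff.1 hn).1))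
    (fun n hn => by
      have hle : t ≤ ‖f n x‖ := hmin n (Finset.mem_sdiff.1 hn).1
      refine ⟨by positivity, div_le_one_of_le₀ hle (norm_nonneg _), ?_⟩
      rcases (norm_nonneg (f n x)).eq_or_lt with h0 | h0
      · have : t = 0 := by linarith
        simp [this]
      · have h0' : (‖f n x‖ : 𝕜) ≠ 0 := by exact_mod_cast h0.ne'
        have h4 := hxu n
        push_cast
        calc (t : 𝕜) * u n = (t : 𝕜) / (‖f n x‖ : 𝕜) * ((‖f n x‖ : 𝕜) * u n) := by
              rw [← mul_assoc, div_mul_cancel₀ _ h0']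
          _ = _ := by rw [← h4])
  have s2 := hA z (A \ B) (B \ A) disjoint_sdiff_sdiff hcard
    (fun n hn => hfz0 n (by
      rcases Finset.mem_union.1 hn with hn | hn
      · exact Finset.mem_union_left _ (Finset.mem_sdiff.1 hn).1
      · exact Finset.mem_union_right _ (Finset.mem_sdiff.1 hn).1))
    u u (fun n _ => hu n) (fun n _ => hu n) (t : 𝕜) (fun n => by
      rw [RCLike.norm_ofReal, abs_of_nonneg ht0, hfz]
      split_ifs with hn
      · simpa using ht0
      · exact hout n (fun hnA => hn (Finset.mem_union_left _ hnA)))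
  simp only [Finset.smul_sum, smul_smul, one_mul] at s2
  have s4 := hS y B
  rw [e2] at s4
  rw [e1]
  exact (s1.trans (s2.trans s3)).trans s4

variable [RCLike 𝕜] [NormedAddCommGroup X] [NormedSpace 𝕜 X] [CompleteSpace X]

/-- A system is `1`-greedy if and only if it is `1`-suppression unconditional and has
Property (A). -/
theorem stmt_11 (hX : ¬ FiniteDimensional 𝕜 X) (e : ℕ → X) (f : ℕ → X →L[𝕜] 𝕜)
    (hsys : BiorthSystem 𝕜 e f) :
    GreedyWith e f 1 ↔
      (SuppressionUnconditionalWith e f 1 ∧ SymmetricLargestCoeffsWith e f 1) := by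
  exact ⟨fun hG => ⟨aux_fwd1 e f hsys hG, aux_fwd2 e f hsys hG⟩,
    fun hh => aux_bwd e f hsys hh.1 hh.2⟩
end

section
/- Let (e_n, e_n*) be a semi-normalized bounded biorthogonal system in an infinite-dimensional Banach space X and let K, C ≥ 1. If the system is K-suppression unconditional and C-symmetric for largest coefficients, then it is K²·C-greedy. -/
open Finset

variable {𝕜 X : Type*}

variable [RCLike 𝕜] [NormedAddCommGroup X] [NormedSpace 𝕜 X] [CompleteSpace X]

/-- Convexity: a norm bound at the vertices extends to the whole cube. -/
theorem cube_norm_le {𝕜 X : Type*} [RCLike 𝕜] [NormedAddCommGroup X] [NormedSpace 𝕜 X]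
    (u v : ℕ → X) (l : ℕ → ℝ) (R : ℝ) (S : Finset ℕ)
    (hl : ∀ n ∈ S, 0 ≤ l n ∧ l n ≤ 1) : ∀ z : X,
    (∀ g : ℕ → X, (∀ n ∈ S, g n = u n ∨ g n = v n) → ‖z + ∑ n ∈ S, g n‖ ≤ R) →
    ‖z + ∑ n ∈ S, (((1 - l n : ℝ) : 𝕜) • u n + ((l n : ℝ) : 𝕜) • v n)‖ ≤ R := by
  classical
  induction S using Finset.induction_on with
  | empty => intro z h; simpa using h u (by simp)
  | insert a S ha ih =>
    intro z h
    have ih' := ih (fun n hn => hl n (Finset.mem_insert_of_mem hn))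
    obtain ⟨h0, h1⟩ := hl a (Finset.mem_insert_self _ _)
    have key : ∀ p : X, (p = u a ∨ p = v a) →
        ‖(z + p) + ∑ n ∈ S, (((1 - l n : ℝ) : 𝕜) • u n + ((l n : ℝ) : 𝕜) • v n)‖ ≤ R := by
      intro p hp
      apply ih'
      intro g hg
      have := h (Function.update g a p) (by
        intro n hn
        by_cases hna : n = a
        · subst hna; simpa using hp
        · simpa [hna] using hg n ((Finset.mem_insert.1 hn).resolve_left hna))
      rw [Finset.sum_insert ha, Function.update_self] at this
      have e2 : ∑ n ∈ S, Function.update g a p n = ∑ n ∈ S, g n := by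
        apply Finset.sum_congr rfl
        intro n hn
        rw [Function.update_of_ne]
        rintro rfl; exact ha hn
      rw [e2, ← add_assoc] at this
      exact this
    have ku := key (u a) (Or.inl rfl)
    have kv := key (v a) (Or.inr rfl)
    rw [Finset.sum_insert ha]
    generalize ∑ n ∈ S, (((1 - l n : ℝ) : 𝕜) • u n + ((l n : ℝ) : 𝕜) • v n) = W at *
    have e3 : z + ((((1 - l a : ℝ) : 𝕜) • u a + ((l a : ℝ) : 𝕜) • v a) + W)
        = ((1 - l a : ℝ) : 𝕜) • (z + u a + W) + ((l a : ℝ) : 𝕜) • (z + v a + W) := by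
      push_cast
      module
    rw [e3]
    calc _ ≤ (1 - l a) * ‖z + u a + W‖ + l a * ‖z + v a + W‖ := by
          refine (norm_add_le _ _).trans (le_of_eq ?_)
          rw [norm_smul, norm_smul, RCLike.norm_ofReal, RCLike.norm_ofReal, abs_of_nonneg h0,
            abs_of_nonneg (sub_nonneg.2 h1)]
      _ ≤ (1 - l a) * R + l a * R := by
          have := sub_nonneg.2 h1
          gcongr
      _ = R := by ring

theorem exists_sign {𝕜 : Type*} [RCLike 𝕜] (a : 𝕜) : ∃ s : 𝕜, ‖s‖ = 1 ∧ a = (‖a‖ : 𝕜) * s := by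
  by_cases h : a = 0
  · exact ⟨1, by simp, by simp [h]⟩
  · have : (‖a‖ : 𝕜) ≠ 0 := by simpa using h
    refine ⟨a / ‖a‖, ?_, by field_simp⟩
    rw [norm_div, RCLike.norm_ofReal, abs_norm, div_self (norm_ne_zero_iff.2 h)]

theorem coef_sum {𝕜 X : Type*} [RCLike 𝕜] [NormedAddCommGroup X] [NormedSpace 𝕜 X]
    {e : ℕ → X} {f : ℕ → X →L[𝕜] 𝕜} (hb : ∀ n k, f n (e k) = if n = k then (1 : 𝕜) else 0)
    (B : Finset ℕ) (c : ℕ → 𝕜) (n : ℕ) :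
    f n (∑ k ∈ B, c k • e k) = if n ∈ B then c n else 0 := by
  simp [map_sum, hb]

/-- If the system is `K`-suppression unconditional and `C`-symmetric for largest coefficients
then it is `K²C`-greedy. -/
theorem stmt_13 (hX : ¬ FiniteDimensional 𝕜 X) (e : ℕ → X) (f : ℕ → X →L[𝕜] 𝕜)
    (hsys : BiorthSystem 𝕜 e f) (K C : ℝ) (hK : 1 ≤ K) (hC : 1 ≤ C)
    (hsu : SuppressionUnconditionalWith e f K)
    (hslc : SymmetricLargestCoeffsWith e f C) :
    GreedyWith e f (K ^ 2 * C) := by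
  classical
  obtain ⟨hb, -, -⟩ := hsys
  intro x A hA B hcard α
  set y := x - ∑ n ∈ B, α n • e n with hy
  have hwy : ‖x - greedyProj e f B x‖ ≤ K * ‖y‖ := by
    have h := hsu y B
    have e1 : greedyProj e f B y = greedyProj e f B x - ∑ n ∈ B, α n • e n := by
      unfold greedyProj
      rw [← Finset.sum_sub_distrib]
      apply Finset.sum_congr rfl
      intro n hn
      rw [hy, map_sub, coef_sum hb, if_pos hn, sub_smul]
    rw [e1] at h
    have e2 : y - (greedyProj e f B x - ∑ n ∈ B, α n • e n) = x - greedyProj e f B x := by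
      rw [hy]; abel
    rwa [e2] at h
  have hy0 := norm_nonneg y
  have hcAB : (A \ B).card = (B \ A).card := by
    have h1 := Finset.card_sdiff_add_card_inter A B
    have h2 := Finset.card_sdiff_add_card_inter B A
    rw [Finset.inter_comm] at h2
    omega
  by_cases hne : (A \ B).Nonempty
  swap
  · have h1 : A \ B = ∅ := Finset.not_nonempty_iff_eq_empty.1 hne
    have hAB : A = B :=
      Finset.eq_of_subset_of_card_le (Finset.sdiff_eq_empty_iff_subset.1 h1) hcard.le
    rw [hAB]
    refine hwy.trans (mul_le_mul_of_nonneg_right ?_ hy0)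
    nlinarith [mul_nonneg (sub_nonneg.2 hK) (sub_nonneg.2 hC)]
  obtain ⟨m, hm, hmin⟩ := Finset.exists_min_image (A \ B) (fun n => ‖f n x‖) hne
  set t : ℝ := ‖f m x‖ with ht
  have ht0 : 0 ≤ t := norm_nonneg _
  have hout : ∀ k ∉ A, ‖f k x‖ ≤ t := fun k hk => hA m (Finset.mem_sdiff.1 hm).1 k hk
  choose s hs1 hs2 using fun n => exists_sign (f n x)
  set z := x - greedyProj e f (A ∪ B) x with hz
  have hfz : ∀ n, f n z = if n ∈ A ∪ B then 0 else f n x := by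
    intro n
    rw [hz, greedyProj, map_sub, coef_sum hb (A ∪ B) (fun k => f k x)]
    split_ifs <;> simp
  have hzB : x - greedyProj e f A x = z + ∑ n ∈ B \ A, f n x • e n := by
    rw [hz, greedyProj, greedyProj, ← Finset.union_sdiff_self_eq_union,
      Finset.sum_union Finset.disjoint_sdiff]
    abel
  have hzA : x - greedyProj e f B x = z + ∑ n ∈ A \ B, f n x • e n := by
    rw [hz, greedyProj, greedyProj, Finset.union_comm, ← Finset.union_sdiff_self_eq_union,
      Finset.sum_union Finset.disjoint_sdiff]
    abel
  -- second step: flattening the coefficients on `A \ B`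
  have step2 : ‖z + (t : 𝕜) • ∑ n ∈ A \ B, s n • e n‖ ≤ K * ‖x - greedyProj e f B x‖ := by
    have h := cube_norm_le (𝕜 := 𝕜) (fun _ => (0 : X)) (fun n => f n x • e n)
      (fun n => t / ‖f n x‖) (K * ‖x - greedyProj e f B x‖) (A \ B)
      (fun n hn => ⟨by positivity, div_le_one_of_le₀ (hmin n hn) (norm_nonneg _)⟩) z ?_
    · convert h using 3
      rw [Finset.smul_sum]
      apply Finset.sum_congr rfl
      intro n hn
      rw [smul_zero, zero_add, smul_smul, smul_smul]
      congr 1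
      have h3 := hs2 n
      have h4 := hmin n hn
      by_cases h0 : ‖f n x‖ = 0
      · have : t = 0 := le_antisymm (h0 ▸ h4) ht0
        simp [this]
      · have h0' : ((‖f n x‖ : ℝ) : 𝕜) ≠ 0 := by exact_mod_cast h0
        conv_rhs => rw [h3]
        push_cast
        rw [← mul_assoc]
        simp only [norm_mul, RCLike.norm_ofReal, abs_norm, hs1, mul_one]
        rw [div_mul_cancel₀ _ h0']
    · intro g hg
      set w := x - greedyProj e f B x with hw
      have h := hsu w ((A \ B).filter (fun n => g n = 0))
      convert h using 2
      have e1 : greedyProj e f ((A \ B).filter (fun n => g n = 0)) w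
          = ∑ n ∈ A \ B, if g n = 0 then f n x • e n else 0 := by
        rw [greedyProj, ← Finset.sum_filter]
        apply Finset.sum_congr rfl
        intro n hn
        have hnB := (Finset.mem_sdiff.1 (Finset.mem_filter.1 hn).1).2
        rw [hw, greedyProj, map_sub, coef_sum hb B (fun k => f k x), if_neg hnB, sub_zero]
      rw [e1, hzA, add_sub_assoc]
      congr 1
      rw [← Finset.sum_sub_distrib]
      apply Finset.sum_congr rfl
      intro n hn
      by_cases h0 : g n = 0
      · simp [h0]
      · rw [if_neg h0, sub_zero]
        exact (hg n hn).resolve_left h0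
  -- first step: enlarging the coefficients on `B \ A` and applying symmetry
  have step1 : ‖x - greedyProj e f A x‖ ≤ C * ‖z + (t : 𝕜) • ∑ n ∈ A \ B, s n • e n‖ := by
    rw [hzB]
    have h := cube_norm_le (𝕜 := 𝕜) (fun n => (t : 𝕜) • (-s n) • e n)
      (fun n => (t : 𝕜) • s n • e n)
      (fun n => (1 + ‖f n x‖ / t) / 2) (C * ‖z + (t : 𝕜) • ∑ n ∈ A \ B, s n • e n‖) (B \ A)
      (fun n hn => ⟨by positivity, by
        have := div_le_one_of_le₀ (hout n (Finset.mem_sdiff.1 hn).2) ht0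
        linarith⟩) z ?_
    · convert h using 3
      apply Finset.sum_congr rfl
      intro n hn
      have hr := hout n (Finset.mem_sdiff.1 hn).2
      have e1 : ∀ r : ℝ, ((1 - (1 + r) / 2 : ℝ) : 𝕜) • (t : 𝕜) • (-s n) • e n
          + (((1 + r) / 2 : ℝ) : 𝕜) • (t : 𝕜) • s n • e n = (((r * t : ℝ) : 𝕜) * s n) • e n := by
        intro r
        push_cast
        module
      rw [e1]
      have e2 : ‖f n x‖ / t * t = ‖f n x‖ := by
        by_cases h0 : t = 0
        · rw [h0] at hr ⊢
          simp [le_antisymm hr (norm_nonneg _)]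
        · field_simp
      rw [e2, ← hs2 n]
    · intro g hg
      have h := hslc z (A \ B) (B \ A) disjoint_sdiff_sdiff hcAB
        (by
          intro n hn
          rw [hfz, if_pos]
          simp only [Finset.mem_union, Finset.mem_sdiff] at hn ⊢
          tauto)
        s (fun n => if g n = (t : 𝕜) • s n • e n then s n else -s n)
        (fun n _ => hs1 n)
        (fun n _ => by
          split_ifs
          · exact hs1 n
          · rw [norm_neg, hs1 n])
        (t : 𝕜)
        (by
          intro n
          rw [hfz, RCLike.norm_ofReal, abs_of_nonneg ht0]
          split_ifs with h0
          · simpa using ht0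
          · exact hout n (fun h1 => h0 (Finset.mem_union_left _ h1)))
      convert h using 3
      rw [Finset.smul_sum]
      apply Finset.sum_congr rfl
      intro n hn
      split_ifs with h0
      · exact h0
      · exact (hg n hn).resolve_right h0
  calc _ ≤ C * ‖z + (t : 𝕜) • ∑ n ∈ A \ B, s n • e n‖ := step1
    _ ≤ C * (K * (K * ‖y‖)) := by gcongr; exact step2.trans (by gcongr)
    _ = _ := by ring
end
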